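/- arXiv:1002.3448 — 2 statements merged into one kernel-verified Lean document; each statement's English description precedes it below -/
import Mathlib

section
/- Let φ̄ and φ_1, φ_2, φ_3, … be functions in Φ(d) such that φ_n ≤ φ̄ pointwise for all n ∈ ℕ, and suppose the set C := { x ∈ ℝ^d : liminf_{n→∞} φ_n(x) > −∞ } is nonempty. Then there exist a subsequence (φ_{n(k)})_k of (φ_n)_n and a function φ ∈ Φ(d) such that C ⊆ dom(φ) := {φ > −∞}, lim_{k→∞, x→y} φ_{n(k)}(x) = φ(y) for all y ∈ interior(dom(φ)), and limsup_{k→∞, x→y} φ_{n(k)}(x) ≤ φ(y) ≤ φ̄(y) for all y ∈ ℝ^d. -/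
open MeasureTheory Filter Topology Set
open scoped ENNReal RealInnerProductSpace BoundedContinuousFunction

noncomputable section

/-- Truncation of an extended real number to `ℝ≥0∞`. -/
def EReal.toENN (x : EReal) : ℝ≥0∞ := if x = ⊤ then ⊤ else ENNReal.ofReal x.toReal

/-- The real-valued exponential of an extended real number (`⊤` is sent to `0`,
but this value is never used for functions in the class `Φ`). -/
def EReal.expR (x : EReal) : ℝ := (EReal.exp x).toReal

/-- The class `Φ(d)`: upper semicontinuous, concave functions `φ : E → [-∞, ∞)`
which are coercive in the sense that `φ x → -∞` as `‖x‖ → ∞`. -/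
def IsPhi {E : Type*} [NormedAddCommGroup E] [NormedSpace ℝ E] (φ : E → EReal) : Prop :=
  UpperSemicontinuous φ ∧ (∀ x, φ x ≠ ⊤) ∧
  (∀ x y : E, ∀ a b : ℝ, 0 < a → 0 < b → a + b = 1 →
    (a : EReal) * φ x + (b : EReal) * φ y ≤ φ (a • x + b • y)) ∧
  Tendsto φ (Filter.comap (fun x : E => ‖x‖) atTop) (𝓝 ⊥)

/-- The integral of an `EReal`-valued function with respect to a measure,
defined as the difference of the integrals of the positive and negative parts. -/
def eint {E : Type*} [MeasurableSpace E] (Q : Measure E) (φ : E → EReal) : EReal :=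
  ((∫⁻ x, (φ x).toENN ∂Q : ℝ≥0∞) : EReal) - ((∫⁻ x, (-(φ x)).toENN ∂Q : ℝ≥0∞) : EReal)

/-- The log-likelihood-type functional `L(φ, Q) = ∫ φ dQ - ∫ e^{φ(x)} dx + 1`. -/
def Lfun {E : Type*} [NormedAddCommGroup E] [NormedSpace ℝ E] [MeasureSpace E]
    (φ : E → EReal) (Q : Measure E) : EReal :=
  eint Q φ - ((∫⁻ x, EReal.exp (φ x) : ℝ≥0∞) : EReal) + 1

/-- The profile log-likelihood `L(Q) = sup_{φ ∈ Φ} L(φ, Q)`. -/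
def Lprof {E : Type*} [NormedAddCommGroup E] [NormedSpace ℝ E] [MeasureSpace E]
    (Q : Measure E) : EReal :=
  ⨆ φ ∈ {φ : E → EReal | IsPhi φ}, Lfun φ Q

/-- The convex support of a measure: the intersection of all closed convex sets of full
measure. -/
def csupp {E : Type*} [NormedAddCommGroup E] [NormedSpace ℝ E] [MeasurableSpace E]
    (Q : Measure E) : Set E :=
  ⋂₀ {C : Set E | IsClosed C ∧ Convex ℝ C ∧ Q C = 1}

/-- `ψ` is the (a) maximizer of `L(·, Q)` over `Φ`, i.e. `ψ = ψ(·|Q)`. -/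
def IsMLE {E : Type*} [NormedAddCommGroup E] [NormedSpace ℝ E] [MeasureSpace E]
    (Q : Measure E) (ψ : E → EReal) : Prop :=
  IsPhi ψ ∧ ∀ φ : E → EReal, IsPhi φ → Lfun φ Q ≤ Lfun ψ Q

/-- Weak convergence of a sequence of measures. -/
def WConv {E : Type*} [NormedAddCommGroup E] [MeasurableSpace E]
    (Qn : ℕ → Measure E) (Q : Measure E) : Prop :=
  ∀ g : E →ᵇ ℝ, Tendsto (fun n => ∫ x, g x ∂(Qn n)) atTop (𝓝 (∫ x, g x ∂Q))

/-- The Mallows (Wasserstein-1, Kantorovich–Rubinstein) distance. -/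
def D1 {E : Type*} [NormedAddCommGroup E] [MeasurableSpace E] (Q Q' : Measure E) : ℝ :=
  sSup {r : ℝ | ∃ h : E → ℝ, LipschitzWith 1 h ∧ r = |(∫ x, h x ∂Q) - ∫ x, h x ∂Q'|}

/-- The bounded Lipschitz distance. -/
def DBL (Q Q' : Measure ℝ) : ℝ :=
  sSup {r : ℝ | ∃ h : ℝ → ℝ, (∀ x, |h x| ≤ 1) ∧ LipschitzWith 1 h ∧
    r = |(∫ x, h x ∂Q) - ∫ x, h x ∂Q'|}

/-- The Kolmogorov–Smirnov distance. -/
def DKS (Q Q' : Measure ℝ) : ℝ :=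
  ⨆ t : ℝ, |(Q' (Set.Iic t)).toReal - (Q (Set.Iic t)).toReal|

/-- Convolution of two measures. -/
def mconv {E : Type*} [NormedAddCommGroup E] [MeasurableSpace E] (Q R : Measure E) : Measure E :=
  (Q.prod R).map (fun p => p.1 + p.2)

/-- The empirical measure of a finite tuple of real numbers. -/
def empQ {n : ℕ} (v : Fin n → ℝ) : Measure ℝ :=
  ((n : ℝ≥0∞))⁻¹ • ∑ i, Measure.dirac (v i)

end

lemma IsPhi.conc_real {E : Type*} [NormedAddCommGroup E] [NormedSpace ℝ E] {ψ : E → EReal}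
    (h : IsPhi ψ) {x y : E} {a b c e : ℝ} (ha : 0 < a) (hb : 0 < b) (hab : a + b = 1)
    (hc : (c : EReal) ≤ ψ x) (he : (e : EReal) ≤ ψ y) :
    ((a * c + b * e : ℝ) : EReal) ≤ ψ (a • x + b • y) := by
  refine le_trans ?_ (h.2.2.1 x y a b ha hb hab)
  rw [EReal.coe_add, EReal.coe_mul, EReal.coe_mul]
  have ha' : (0 : EReal) ≤ (a : EReal) := by exact_mod_cast ha.le
  have hb' : (0 : EReal) ≤ (b : EReal) := by exact_mod_cast hb.le
  exact add_le_add (mul_le_mul_of_nonneg_left hc ha') (mul_le_mul_of_nonneg_left he hb')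

/-- A closed convex set that nearly meets every point of a ball contains a smaller ball. -/
lemma ball_subset_of_near {E : Type*} [NormedAddCommGroup E] [InnerProductSpace ℝ E]
    [CompleteSpace E] {A : Set E} (hA : IsClosed A) (hc : Convex ℝ A) {y : E} {r : ℝ} (hr : 0 < r)
    (h : ∀ w ∈ Metric.closedBall y r, ∃ a ∈ A, dist w a ≤ r / 4) :
    Metric.ball y (r / 4) ⊆ A := by
  intro z hz
  by_contra hzA
  obtain ⟨f, u, hfu, huz⟩ := geometric_hahn_banach_closed_point hc hA hzA
  set v := (InnerProductSpace.toDual ℝ E).symm f with hv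
  have hf : ∀ x, f x = inner ℝ v x := fun x => by
    rw [hv, InnerProductSpace.toDual_symm_apply]
  have hw : y + (r / ‖v‖) • v ∈ Metric.closedBall y r := by
    rw [Metric.mem_closedBall, dist_eq_norm, add_sub_cancel_left, norm_smul, Real.norm_eq_abs,
      abs_of_nonneg (by positivity)]
    by_cases h0 : ‖v‖ = 0
    · simp [h0, hr.le]
    · field_simp; exact le_refl _
  obtain ⟨a, haA, hda⟩ := h _ hw
  have h1 := hfu a haA
  have h2 : f (y + (r / ‖v‖) • v) = f y + r * ‖v‖ := by
    rw [map_add, map_smul, hf v, real_inner_self_eq_norm_sq, smul_eq_mul]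
    by_cases h0 : ‖v‖ = 0
    · simp [h0]
    · field_simp
  have h3 : f (y + (r / ‖v‖) • v) - f a ≤ ‖v‖ * (r / 4) := by
    rw [← map_sub, hf]
    refine (real_inner_le_norm _ _).trans ?_
    rw [← dist_eq_norm]
    gcongr
  have h4 : f z - f y ≤ ‖v‖ * (r / 4) := by
    rw [← map_sub, hf]
    refine (real_inner_le_norm _ _).trans ?_
    rw [← dist_eq_norm]
    have := (Metric.mem_ball.1 hz).le
    gcongr
  have h5 : 0 ≤ r * ‖v‖ := by positivity
  linarith

lemma IsPhi.convex_superlevel {E : Type*} [NormedAddCommGroup E] [NormedSpace ℝ E] {ψ : E → EReal}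
    (h : IsPhi ψ) (m : ℝ) : Convex ℝ {x | (m : EReal) ≤ ψ x} := by
  rw [convex_iff_forall_pos]
  intro x hx y hy a b ha hb hab
  have := h.conc_real ha hb hab hx hy
  have e : a * m + b * m = m := by rw [← add_mul, hab, one_mul]
  rw [e] at this
  exact this

/-- **Lemma 5 (pointwise limits of sequences in `Φ`).** If `φ_n ∈ Φ(d)` with `φ_n ≤ φ̄ ∈ Φ(d)`
and `C = {x : liminf φ_n(x) > -∞}` is nonempty, then some subsequence `φ_{n(k)}` converges
to a function `φ ∈ Φ(d)` with `C ⊆ dom φ`, locally uniformly in the sense of the stated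
sequential limits, with `limsup φ_{n(k)}(x) ≤ φ(y) ≤ φ̄(y)` as `x → y` for every `y`. -/
theorem subsequence_limit_in_Phi {d : ℕ}
    (φbar : EuclideanSpace ℝ (Fin d) → EReal) (φs : ℕ → EuclideanSpace ℝ (Fin d) → EReal)
    (hbar : IsPhi φbar) (hφs : ∀ n, IsPhi (φs n)) (hle : ∀ n x, φs n x ≤ φbar x)
    (hC : {x : EuclideanSpace ℝ (Fin d) |
      ⊥ < Filter.liminf (fun n => φs n x) atTop}.Nonempty) :
    ∃ k : ℕ → ℕ, StrictMono k ∧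
    ∃ φ : EuclideanSpace ℝ (Fin d) → EReal, IsPhi φ ∧
      {x | ⊥ < Filter.liminf (fun n => φs n x) atTop} ⊆ {x | φ x ≠ ⊥} ∧
      (∀ y ∈ interior {x | φ x ≠ ⊥},
        ∀ x : ℕ → EuclideanSpace ℝ (Fin d), Tendsto x atTop (𝓝 y) →
          Tendsto (fun j => φs (k j) (x j)) atTop (𝓝 (φ y))) ∧
      (∀ y : EuclideanSpace ℝ (Fin d),
        (∀ x : ℕ → EuclideanSpace ℝ (Fin d), Tendsto x atTop (𝓝 y) →
          Filter.limsup (fun j => φs (k j) (x j)) atTop ≤ φ y) ∧ φ y ≤ φbar y) := by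
  classical
  let B := TopologicalSpace.countableBasis (EuclideanSpace ℝ (Fin d))
  have hB : TopologicalSpace.IsTopologicalBasis B := TopologicalSpace.isBasis_countableBasis _
  have : Countable B := (TopologicalSpace.countable_countableBasis _).to_subtype
  let S : ℕ → B → EReal := fun n U => ⨆ x ∈ U.1, φs n x
  obtain ⟨s, k, hk, hs⟩ := CompactSpace.tendsto_subseq S
  rw [tendsto_pi_nhds] at hs
  have hSle : ∀ n (U : B) x, x ∈ U.1 → φs n x ≤ S n U := fun n U x hx =>
    le_iSup₂ (f := fun x (_ : x ∈ U.1) => φs n x) x hx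
  let φ : EuclideanSpace ℝ (Fin d) → EReal := fun y => ⨅ U : B, ⨅ _ : y ∈ U.1, s U
  have hφs_le : ∀ y (U : B), y ∈ U.1 → φ y ≤ s U := fun y U hy => iInf₂_le U hy
  have hlt : ∀ y c, φ y < c → ∃ U : B, y ∈ U.1 ∧ s U < c := by
    intro y c h
    obtain ⟨U, hU⟩ := iInf_lt_iff.1 h
    obtain ⟨hy, hU⟩ := iInf_lt_iff.1 hU
    exact ⟨U, hy, hU⟩
  -- recovery
  have hrec : ∀ y c, c < φ y → ∀ V ∈ 𝓝 y, ∀ᶠ j in atTop, ∃ x ∈ V, c < φs (k j) x := by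
    intro y c hc V hV
    obtain ⟨U, hU, hyU, hUV⟩ := hB.mem_nhds_iff.1 hV
    have h1 : c < s ⟨U, hU⟩ := hc.trans_le (hφs_le y ⟨U, hU⟩ hyU)
    filter_upwards [(hs ⟨U, hU⟩).eventually (lt_mem_nhds h1)] with j hj
    obtain ⟨x, hx⟩ := lt_iSup_iff.1 hj
    obtain ⟨hxU, hx⟩ := lt_iSup_iff.1 hx
    exact ⟨x, hUV hxU, hx⟩
  have hup : ∀ y c, φ y < c → ∀ x : ℕ → EuclideanSpace ℝ (Fin d), Tendsto x atTop (𝓝 y) →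
      ∀ᶠ j in atTop, φs (k j) (x j) < c := by
    intro y c hc x hx
    obtain ⟨U, hyU, hU⟩ := hlt y c hc
    filter_upwards [(hs U).eventually (gt_mem_nhds hU),
      hx.eventually ((hB.isOpen U.2).mem_nhds hyU)] with j h1 h2
    exact (hSle _ U _ h2).trans_lt h1
  have hφbar : ∀ y, φ y ≤ φbar y := by
    intro y
    refine le_of_forall_gt_imp_ge_of_dense fun c hc => ?_
    obtain ⟨U, hU, hyU, hUV⟩ := hB.mem_nhds_iff.1 (hbar.1 y c hc)
    refine (hφs_le y ⟨U, hU⟩ hyU).trans ?_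
    refine le_of_tendsto' (hs ⟨U, hU⟩) fun j => ?_
    exact iSup₂_le fun x hx => (hle _ x).trans (le_of_lt (hUV hx))
  have hconc : ∀ x y : EuclideanSpace ℝ (Fin d), ∀ a b : ℝ, 0 < a → 0 < b → a + b = 1 →
      ∀ c e : ℝ, (c : EReal) < φ x → (e : EReal) < φ y →
      ((a * c + b * e : ℝ) : EReal) ≤ φ (a • x + b • y) := by
    intro x y a b ha hb hab c e hc he
    refine le_iInf₂ fun U hU => ?_
    have hcont : ContinuousAt (fun p : EuclideanSpace ℝ (Fin d) × EuclideanSpace ℝ (Fin d) =>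
      a • p.1 + b • p.2) (x, y) := by fun_prop
    have hm := hcont.preimage_mem_nhds ((hB.isOpen U.2).mem_nhds hU)
    rw [nhds_prod_eq, Filter.mem_prod_iff] at hm
    obtain ⟨V, hV, W, hW, hVW⟩ := hm
    refine ge_of_tendsto (hs U) ?_
    filter_upwards [hrec x c hc V hV, hrec y e he W hW] with j ⟨p, hp, hp'⟩ ⟨q, hq, hq'⟩
    refine ((hφs (k j)).conc_real ha hb hab hp'.le hq'.le).trans ?_
    exact hSle _ U _ (hVW (Set.mk_mem_prod hp hq))
  have hphi_ne_top : ∀ x, φ x ≠ ⊤ := fun x h => hbar.2.1 x (top_le_iff.1 (h ▸ hφbar x))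
  refine ⟨k, hk, φ, ⟨?_, hphi_ne_top, ?_, ?_⟩, ?_, ?_, fun y => ⟨?_, hφbar y⟩⟩
  · intro y c hc
    obtain ⟨U, hyU, hU⟩ := hlt y c hc
    filter_upwards [(hB.isOpen U.2).mem_nhds hyU] with z hz
    exact (hφs_le z U hz).trans_lt hU
  · intro x y a b ha hb hab
    rcases eq_or_ne (φ x) ⊥ with hx | hx
    · rw [hx, EReal.coe_mul_bot_of_pos ha, EReal.bot_add]; exact bot_le
    rcases eq_or_ne (φ y) ⊥ with hy | hy
    · rw [hy, EReal.coe_mul_bot_of_pos hb, EReal.add_bot]; exact bot_le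
    obtain ⟨p, hp⟩ : ∃ p : ℝ, (p : EReal) = φ x :=
      ⟨_, EReal.coe_toReal (hphi_ne_top x) hx⟩
    obtain ⟨q, hq⟩ : ∃ q : ℝ, (q : EReal) = φ y :=
      ⟨_, EReal.coe_toReal (hphi_ne_top y) hy⟩
    rw [← hp, ← hq, ← EReal.coe_mul, ← EReal.coe_mul, ← EReal.coe_add]
    refine le_of_forall_lt_imp_le_of_dense fun t ht => ?_
    induction t with
    | bot => exact bot_le
    | top => exact absurd ht (not_lt.2 le_top)
    | coe t =>
      have ht' : t < a * p + b * q := by exact_mod_cast ht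
      have := hconc x y a b ha hb hab (p - (a * p + b * q - t)) (q - (a * p + b * q - t))
        (by rw [← hp]; exact_mod_cast (by linarith)) (by rw [← hq]; exact_mod_cast (by linarith))
      have e : a * (p - (a * p + b * q - t)) + b * (q - (a * p + b * q - t)) = t := by
        have : b = 1 - a := by linarith
        subst this; ring
      rwa [e] at this
  · exact tendsto_of_tendsto_of_tendsto_of_le_of_le tendsto_const_nhds hbar.2.2.2
      (fun _ => bot_le) hφbar
  · intro x hx
    obtain ⟨c, hc, hc'⟩ := exists_between (show ⊥ < liminf (fun n => φs n x) atTop from hx)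
    have h1 := hk.tendsto_atTop.eventually (eventually_lt_of_lt_liminf hc')
    have h2 : c ≤ φ x := le_iInf₂ fun U hU => ge_of_tendsto (hs U) (by
      filter_upwards [h1] with j hj
      exact hj.le.trans (hSle _ U _ hU))
    exact (hc.trans_le h2).ne'
  · intro y hy x hx
    rw [tendsto_order]
    refine ⟨fun t ht => ?_, fun c hc => hup y c hc x hx⟩
    -- uniform lower bound near y
    obtain ⟨r, hr, hball⟩ := Metric.nhds_basis_closedBall.mem_iff.1 (mem_interior_iff_mem_nhds.1 hy)
    have hlow : ∃ m : ℝ, ∀ᶠ j in atTop, ∀ z ∈ Metric.ball y (r / 4), (m : EReal) ≤ φs (k j) z := by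
      obtain ⟨N, hN, hNfin, hcov⟩ := (isCompact_closedBall y r).finite_cover_balls
        (e := r / 8) (by positivity)
      have hm : ∀ v ∈ N, ∃ m : ℝ, (m : EReal) < φ v := fun v hv => by
        obtain ⟨m, -, hm⟩ := EReal.lt_iff_exists_real_btwn.1 (bot_lt_iff_ne_bot.2 (hball (hN hv)))
        exact ⟨m, hm⟩
      choose! m hm using hm
      obtain ⟨m₀, hm₀⟩ := (hNfin.image m).bddBelow
      refine ⟨m₀, ?_⟩
      have hev : ∀ᶠ j in atTop, ∀ v ∈ N, ∃ a ∈ Metric.ball v (r / 8), (m v : EReal) < φs (k j) a :=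
        (eventually_all_finite hNfin).2 fun v hv =>
          hrec v (m v) (hm v hv) _ (Metric.ball_mem_nhds _ (by positivity))
      filter_upwards [hev] with j hj
      refine ball_subset_of_near (A := {z | (m₀ : EReal) ≤ φs (k j) z})
        ((hφs (k j)).1.isClosed_preimage _) ((hφs (k j)).convex_superlevel m₀) hr ?_
      intro w hw
      obtain ⟨v, hv, hwv⟩ := mem_iUnion₂.1 (hcov hw)
      obtain ⟨a, ha, hma⟩ := hj v hv
      refine ⟨a, le_trans ?_ hma.le, ?_⟩
      · exact_mod_cast hm₀ (mem_image_of_mem m hv)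
      · have h1 := dist_triangle_right w a v
        rw [Metric.mem_ball] at hwv ha
        linarith
    obtain ⟨m, hm⟩ := hlow
    obtain ⟨t', ht', ht'φ⟩ := EReal.lt_iff_exists_real_btwn.1 ht
    obtain ⟨c, hc, hcφ⟩ := EReal.lt_iff_exists_real_btwn.1 ht'φ
    have htc : t' < c := by exact_mod_cast hc
    obtain ⟨l, hl0, hl1, hl⟩ : ∃ l : ℝ, 0 < l ∧ l < 1 ∧ t' ≤ (1 - l) * c + l * m := by
      have h : Tendsto (fun l : ℝ => (1 - l) * c + l * m) (𝓝[>] 0) (𝓝 ((1 - 0) * c + 0 * m)) :=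
        Tendsto.mono_left (Continuous.tendsto (by fun_prop) 0) nhdsWithin_le_nhds
      have h1 := h.eventually (lt_mem_nhds (show t' < (1 - 0) * c + 0 * m by simpa using htc))
      have h2 : ∀ᶠ l : ℝ in 𝓝[>] 0, l ∈ Set.Ioo (0 : ℝ) 1 := Ioo_mem_nhdsGT one_pos
      obtain ⟨l, hl, hl'⟩ := (h1.and h2).exists
      exact ⟨l, hl'.1, hl'.2, hl.le⟩
    have hδ : 0 < l * r / 16 := by positivity
    filter_upwards [hm, hrec y c hcφ _ (Metric.ball_mem_nhds y hδ),
      hx.eventually (Metric.ball_mem_nhds y hδ)] with j hj ⟨p, hp, hcp⟩ hxj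
    have hpx : dist (x j) p < l * (r / 8) := by
      have := dist_triangle_right (x j) p y
      rw [Metric.mem_ball] at hp
      linarith
    have hw : p + l⁻¹ • (x j - p) ∈ Metric.ball y (r / 4) := by
      rw [Metric.mem_ball] at hp ⊢
      have h1 : dist (p + l⁻¹ • (x j - p)) p < r / 8 := by
        rw [dist_eq_norm, add_sub_cancel_left, norm_smul, norm_inv, Real.norm_eq_abs,
          abs_of_pos hl0, ← dist_eq_norm, inv_mul_lt_iff₀ hl0]
        exact hpx
      have h2 := dist_triangle (p + l⁻¹ • (x j - p)) p y
      nlinarith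
    have key := (hφs (k j)).conc_real (sub_pos.2 hl1) hl0 (by ring) hcp.le (hj _ hw)
    have e : (1 - l) • p + l • (p + l⁻¹ • (x j - p)) = x j := by
      rw [smul_add, smul_inv_smul₀ hl0.ne']
      module
    rw [e] at key
    exact ht'.trans_le (le_trans (by exact_mod_cast hl) key)
  · intro x hx
    refine le_of_forall_gt_imp_ge_of_dense fun c hc => ?_
    exact limsup_le_of_le (by isBoundedDefault) ((hup y c hc x hx).mono fun _ h => h.le)
end

section
/- Let Q and Q' be probability distributions on the real line. Then for every r > 0, D_BL(Q, Q') ≤ 4 Q(ℝ \ (−r, r]) + 4(r + 1) D_KS(Q, Q'), where D_BL is the bounded Lipschitz distance and D_KS the Kolmogorov–Smirnov distance. -/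
open MeasureTheory Filter Topology Set
open scoped ENNReal RealInnerProductSpace BoundedContinuousFunction

/-- Step-function approximation of a clamped 1-Lipschitz function. -/
lemma step_approx (h : ℝ → ℝ) (hL : LipschitzWith 1 h) (a δ : ℝ) (hδ : 0 < δ) (n : ℕ) (x : ℝ) :
    |h (max a (min x (a + n * δ))) - (h (a + n * δ) - ∑ k ∈ Finset.range n,
      (h (a + (k + 1 : ℕ) * δ) - h (a + k * δ)) * (Set.Iic (a + k * δ)).indicator 1 x)| ≤ δ := by
  have hl : ∀ x y, |h x - h y| ≤ |x - y| := by
    intro x y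
    have := hL.dist_le_mul x y
    simpa [Real.dist_eq] using this
  induction n with
  | zero => simp [hδ.le]
  | succ n ih =>
    have e : a + ((n + 1 : ℕ) : ℝ) * δ = a + n * δ + δ := by push_cast; ring
    by_cases hx : x ≤ a + n * δ
    · rw [Finset.sum_range_succ, Set.indicator_of_mem (by simpa using hx)]
      have h1 : min x (a + ((n + 1 : ℕ) : ℝ) * δ) = min x (a + n * δ) := by
        rw [min_eq_left hx, min_eq_left (by rw [e]; linarith)]
      rw [h1]
      convert ih using 2
      simp only [Pi.one_apply]
      ring
    · push Not at hx
      rw [Finset.sum_eq_zero, sub_zero]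
      · refine (hl _ _).trans ?_
        rw [e]
        have : 0 ≤ n * δ := by positivity
        rw [max_eq_right (le_min (by linarith) (by linarith)), abs_le]
        constructor
        · have : a + n * δ ≤ min x (a + n * δ + δ) := le_min hx.le (by linarith)
          linarith
        · have := min_le_right x (a + n * δ + δ)
          linarith
      · intro k hk
        have hk' : (k : ℝ) ≤ n := by exact_mod_cast Nat.lt_succ_iff.1 (Finset.mem_range.1 hk)
        have : (k : ℝ) * δ ≤ n * δ := by gcongr
        rw [Set.indicator_of_notMem, mul_zero]
        simp only [Set.mem_Iic, not_le]
        linarith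

lemma DKS_bound (Q Q' : Measure ℝ) [IsProbabilityMeasure Q] [IsProbabilityMeasure Q'] (t : ℝ) :
    |Q'.real (Set.Iic t) - Q.real (Set.Iic t)| ≤ DKS Q Q' := by
  refine le_ciSup (f := fun t : ℝ => |(Q' (Set.Iic t)).toReal - (Q (Set.Iic t)).toReal|)
    ⟨1, ?_⟩ t
  rintro _ ⟨s, rfl⟩
  have h1 : Q.real (Set.Iic s) ≤ 1 := measureReal_le_one
  have h2 : Q'.real (Set.Iic s) ≤ 1 := measureReal_le_one
  have h3 : 0 ≤ Q.real (Set.Iic s) := measureReal_nonneg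
  have h4 : 0 ≤ Q'.real (Set.Iic s) := measureReal_nonneg
  change |Q'.real (Set.Iic s) - Q.real (Set.Iic s)| ≤ 1
  rw [abs_le]; constructor <;> linarith

lemma integral_diff_le (μ : Measure ℝ) [IsProbabilityMeasure μ] (f g : ℝ → ℝ)
    (hf : Integrable f μ) (hg : Integrable g μ) (S : Set ℝ) (hS : MeasurableSet S) (c : ℝ)
    (h : ∀ x, |f x - g x| ≤ S.indicator (fun _ => c) x) :
    |∫ x, f x ∂μ - ∫ x, g x ∂μ| ≤ c * μ.real S := by
  rw [← integral_sub hf hg]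
  refine abs_integral_le_integral_abs.trans ?_
  calc _ ≤ ∫ x, S.indicator (fun _ => c) x ∂μ :=
        integral_mono (hf.sub hg).abs ((integrable_const c).indicator hS) h
    _ = _ := by rw [integral_indicator_const _ hS]; simp [mul_comm]

lemma clamp_bound (Q Q' : Measure ℝ) [IsProbabilityMeasure Q] [IsProbabilityMeasure Q']
    (h : ℝ → ℝ) (hb : ∀ x, |h x| ≤ 1) (hL : LipschitzWith 1 h) (r : ℝ) (hr : 0 < r) :
    |∫ x, h (max (-r) (min x r)) ∂Q - ∫ x, h (max (-r) (min x r)) ∂Q'| ≤ 2 * r * DKS Q Q' := by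
  have hl : ∀ x y, |h x - h y| ≤ |x - y| := by
    intro x y
    have := hL.dist_le_mul x y
    simpa [Real.dist_eq] using this
  have hc := hL.continuous
  have key : ∀ N : ℕ, |∫ x, h (max (-r) (min x r)) ∂Q - ∫ x, h (max (-r) (min x r)) ∂Q'|
      ≤ 2 * r * DKS Q Q' + 4 * r * (1 / ((N : ℝ) + 1)) := by
    intro N
    obtain ⟨δ, hδ⟩ : ∃ δ, δ = 2 * r / (N + 1) := ⟨_, rfl⟩
    have hδ0 : 0 < δ := by rw [hδ]; positivity
    have hN : ((N + 1 : ℕ) : ℝ) * δ = 2 * r := by rw [hδ]; push_cast; field_simp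
    have hend : -r + ((N + 1 : ℕ) : ℝ) * δ = r := by rw [hN]; ring
    have hap := step_approx h hL (-r) δ hδ0 (N + 1)
    rw [hend] at hap
    obtain ⟨c, hcdef⟩ : ∃ c : ℕ → ℝ, c = fun k => h (-r + (k + 1 : ℕ) * δ) - h (-r + k * δ) :=
      ⟨_, rfl⟩
    have hcb : ∀ k, |c k| ≤ δ := by
      intro k
      rw [hcdef]
      refine (hl _ _).trans (le_of_eq ?_)
      rw [show (-r + ((k + 1 : ℕ) : ℝ) * δ - (-r + k * δ)) = δ by push_cast; ring,
        abs_of_pos hδ0]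
    obtain ⟨G, hG⟩ : ∃ G : ℝ → ℝ, G = fun x => h r - ∑ k ∈ Finset.range (N + 1),
      c k * (Set.Iic (-r + k * δ)).indicator 1 x := ⟨_, rfl⟩
    have hap' : ∀ x, |h (max (-r) (min x r)) - G x| ≤ Set.univ.indicator (fun _ => δ) x := by
      intro x; rw [hG, hcdef]; simpa using hap x
    have hi1 : ∀ (μ : Measure ℝ) [IsProbabilityMeasure μ] (k : ℕ),
        Integrable (fun x => c k * (Set.Iic (-r + k * δ)).indicator (1 : ℝ → ℝ) x) μ := by
      intro μ _ k
      exact ((integrable_const (1 : ℝ)).indicator measurableSet_Iic).const_mul _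
    have hiG : ∀ (μ : Measure ℝ) [IsProbabilityMeasure μ], Integrable G μ := by
      intro μ _
      rw [hG]
      exact (integrable_const _).sub (integrable_finsetSum _ fun k _ => hi1 μ k)
    have hIG : ∀ (μ : Measure ℝ) [IsProbabilityMeasure μ], ∫ x, G x ∂μ =
        h r - ∑ k ∈ Finset.range (N + 1), c k * μ.real (Set.Iic (-r + k * δ)) := by
      intro μ _
      rw [hG, integral_sub (integrable_const _) (integrable_finsetSum _ fun k _ => hi1 μ k),
        integral_finsetSum _ fun k _ => hi1 μ k]
      simp [integral_const_mul, integral_indicator_one]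
    have hih : ∀ (μ : Measure ℝ) [IsProbabilityMeasure μ],
        Integrable (fun x => h (max (-r) (min x r))) μ := by
      intro μ _
      refine Integrable.of_bound (C := 1) (by fun_prop) (ae_of_all _ fun x => hb _)
    have e1 := integral_diff_le Q _ G (hih Q) (hiG Q) _ MeasurableSet.univ δ hap'
    have e2 := integral_diff_le Q' _ G (hih Q') (hiG Q') _ MeasurableSet.univ δ hap'
    have e3 : |∫ x, G x ∂Q - ∫ x, G x ∂Q'| ≤ 2 * r * DKS Q Q' := by
      rw [hIG, hIG, show ∀ a b c : ℝ, a - b - (a - c) = c - b by intros; ring,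
        ← Finset.sum_sub_distrib]
      refine (Finset.abs_sum_le_sum_abs _ _).trans ?_
      calc _ ≤ ∑ k ∈ Finset.range (N + 1), δ * DKS Q Q' := by
            refine Finset.sum_le_sum fun k _ => ?_
            rw [← mul_sub, abs_mul]
            exact mul_le_mul (hcb k) (DKS_bound Q Q' _) (abs_nonneg _) hδ0.le
        _ = _ := by
            rw [Finset.sum_const, Finset.card_range, nsmul_eq_mul, ← mul_assoc, hN]
    simp only [probReal_univ, mul_one] at e1 e2
    have : 4 * r * (1 / ((N : ℝ) + 1)) = 2 * δ := by rw [hδ]; ring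
    rw [this]
    rw [abs_le] at *
    constructor <;> linarith [e1.1, e1.2, e2.1, e2.2, e3.1, e3.2]
  have lim : Tendsto (fun N : ℕ => 2 * r * DKS Q Q' + 4 * r * (1 / ((N : ℝ) + 1))) atTop
      (𝓝 (2 * r * DKS Q Q' + 4 * r * 0)) :=
    (tendsto_one_div_add_atTop_nhds_zero_nat.const_mul _).const_add _
  simpa using ge_of_tendsto' lim key

/-- **Lemma 6.** For probability distributions `Q, Q'` on `ℝ` and any `r > 0`,
`D_BL(Q, Q') ≤ 4 Q(ℝ \ (-r, r]) + 4(r + 1) D_KS(Q, Q')`. -/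
theorem DBL_le_DKS (Q Q' : Measure ℝ) [IsProbabilityMeasure Q] [IsProbabilityMeasure Q']
    (r : ℝ) (hr : 0 < r) :
    DBL Q Q' ≤ 4 * (Q (Set.Ioc (-r) r)ᶜ).toReal + 4 * (r + 1) * DKS Q Q' := by
  change _ ≤ 4 * Q.real (Set.Ioc (-r) r)ᶜ + _
  have hD : 0 ≤ DKS Q Q' := (abs_nonneg _).trans (DKS_bound Q Q' 0)
  have hrD : 0 ≤ r * DKS Q Q' := by positivity
  refine Real.sSup_le ?_ (by positivity)
  rintro _ ⟨h, hb, hL, rfl⟩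
  have hc := hL.continuous
  have hIoc : ∀ (μ : Measure ℝ) [IsProbabilityMeasure μ],
      μ.real (Set.Ioc (-r) r)ᶜ = 1 - (μ.real (Set.Iic r) - μ.real (Set.Iic (-r))) := by
    intro μ _
    rw [probReal_compl_eq_one_sub measurableSet_Ioc, show Set.Ioc (-r) r = Set.Iic r \ Set.Iic (-r) by ext x; simp [and_comm],
      measureReal_diff (Set.Iic_subset_Iic.2 (by linarith)) measurableSet_Iic]
  have hpt : ∀ x, |h x - h (max (-r) (min x r))| ≤
      (Set.Ioc (-r) r)ᶜ.indicator (fun _ => (2 : ℝ)) x := by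
    intro x
    by_cases hx : x ∈ Set.Ioc (-r) r
    · rw [Set.indicator_of_notMem (by simpa using hx), min_eq_left hx.2, max_eq_right hx.1.le]
      simp
    · rw [Set.indicator_of_mem hx]
      have h1 := abs_le.1 (hb x)
      have h2 := abs_le.1 (hb (max (-r) (min x r)))
      rw [abs_le]; constructor <;> linarith [h1.1, h1.2, h2.1, h2.2]
  have hih : ∀ (μ : Measure ℝ) [IsProbabilityMeasure μ],
      Integrable (fun x => h (max (-r) (min x r))) μ := by
    intro μ _
    exact Integrable.of_bound (C := 1) (by fun_prop) (ae_of_all _ fun x => hb _)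
  have hih' : ∀ (μ : Measure ℝ) [IsProbabilityMeasure μ], Integrable h μ := by
    intro μ _
    exact Integrable.of_bound (C := 1) (by fun_prop) (ae_of_all _ fun x => hb _)
  have e1 := integral_diff_le Q _ _ (hih' Q) (hih Q) _ measurableSet_Ioc.compl 2 hpt
  have e2 := integral_diff_le Q' _ _ (hih' Q') (hih Q') _ measurableSet_Ioc.compl 2 hpt
  have e3 := clamp_bound Q Q' h hb hL r hr
  have d1 := DKS_bound Q Q' r
  have d2 := DKS_bound Q Q' (-r)
  rw [hIoc] at e1 e2 ⊢
  rw [abs_le] at *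
  constructor <;> nlinarith [e1.1, e1.2, e2.1, e2.2, e3.1, e3.2, d1.1, d1.2, d2.1, d2.2]
end
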